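/- Let N, m ≥ 1 be integers, let Ψ satisfy condition (K), and let p, q > 0 satisfy p + q ≥ 2. If u ∈ C^{2m}(ℝ^N) is a non-negative solution of −(−Δ)^m u ≥ (Ψ(|·|) * u^p) u^q in ℝ^N, then u ≡ 0. -/

import Mathlib

open MeasureTheory Filter Metric

/-- The Laplacian of `u : ℝ^N → ℝ`, defined via the second iterated Fréchet derivative. -/
noncomputable def lap {N : ℕ} (u : EuclideanSpace ℝ (Fin N) → ℝ) :
    EuclideanSpace ℝ (Fin N) → ℝ :=
  fun x => ∑ i : Fin N,
    iteratedFDeriv ℝ 2 u x ![EuclideanSpace.single i 1, EuclideanSpace.single i 1]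

/-- `negLapPow m u = (-Δ)^m u`, the `m`-fold iterate of the negative Laplacian. -/
noncomputable def negLapPow {N : ℕ} (m : ℕ) (u : EuclideanSpace ℝ (Fin N) → ℝ) :
    EuclideanSpace ℝ (Fin N) → ℝ :=
  (fun v => fun x => -(lap v x))^[m] u

/-- Condition (K) on the kernel `Ψ`. -/
structure CondK (N : ℕ) (Ψ : ℝ → ℝ) : Prop where
  pos : ∀ r : ℝ, 0 < r → 0 < Ψ r
  cont : ContinuousOn (fun x : EuclideanSpace ℝ (Fin N) => Ψ ‖x‖)
    {(0 : EuclideanSpace ℝ (Fin N))}ᶜ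
  locInt : LocallyIntegrable (fun x : EuclideanSpace ℝ (Fin N) => Ψ ‖x‖) volume
  anti : AntitoneOn Ψ (Set.Ioi (0 : ℝ))
  tendsto : Tendsto (fun r : ℝ => r ^ N * Ψ r) atTop atTop

open Topology

/-- The radial weight `(1 - ‖y‖²)₊ ^ k`, supported in the closed unit ball. -/
noncomputable def ballWeight {N : ℕ} (k : ℕ) (y : EuclideanSpace ℝ (Fin N)) : ℝ :=
  max (1 - ‖y‖ ^ 2) 0 ^ k

section BallWeight

variable {N : ℕ}

theorem ballWeight_nonneg (k : ℕ) (y : EuclideanSpace ℝ (Fin N)) : 0 ≤ ballWeight k y :=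
  pow_nonneg (le_max_right _ _) _

theorem ballWeight_le_of_le {j k : ℕ} (h : j ≤ k) (y : EuclideanSpace ℝ (Fin N)) :
    ballWeight k y ≤ ballWeight j y :=
  pow_le_pow_of_le_one (le_max_right _ _) (max_le (by nlinarith [sq_nonneg ‖y‖]) zero_le_one) h

theorem ballWeight_eq_zero {k : ℕ} (hk : k ≠ 0) {y : EuclideanSpace ℝ (Fin N)}
    (hy : 1 ≤ ‖y‖) : ballWeight k y = 0 := by
  rw [ballWeight, max_eq_right (by nlinarith), zero_pow hk]

theorem norm_sq_mul_ballWeight {k : ℕ} (hk : k ≠ 0) (y : EuclideanSpace ℝ (Fin N)) :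
    ‖y‖ ^ 2 * ballWeight k y = ballWeight k y - ballWeight (k + 1) y := by
  rcases le_total 1 ‖y‖ with h | h
  · rw [ballWeight_eq_zero hk h, ballWeight_eq_zero (Nat.succ_ne_zero k) h]; ring
  · simp only [ballWeight, max_eq_left (show (0 : ℝ) ≤ 1 - ‖y‖ ^ 2 by nlinarith [norm_nonneg y])]
    ring

theorem continuous_ballWeight (k : ℕ) :
    Continuous (ballWeight k : EuclideanSpace ℝ (Fin N) → ℝ) := by
  unfold ballWeight; fun_prop

theorem hasCompactSupport_ballWeight {k : ℕ} (hk : k ≠ 0) :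
    HasCompactSupport (ballWeight k : EuclideanSpace ℝ (Fin N) → ℝ) :=
  HasCompactSupport.intro (isCompact_closedBall 0 1) fun y hy =>
    ballWeight_eq_zero hk (by simpa using (not_le.1 (by simpa using hy)).le)

theorem integrable_mul_ballWeight {k : ℕ} (hk : k ≠ 0) {f : EuclideanSpace ℝ (Fin N) → ℝ}
    (hf : Continuous f) : Integrable (fun y => f y * ballWeight k y) :=
  (hf.mul (continuous_ballWeight k)).integrable_of_hasCompactSupport
    (hasCompactSupport_ballWeight hk).mul_left

theorem hasDerivAt_max_zero_pow {k : ℕ} (hk : k ≠ 0) (t : ℝ) :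
    HasDerivAt (fun t : ℝ => max t 0 ^ (k + 1)) ((k + 1) * max t 0 ^ k) t := by
  rcases lt_trichotomy t 0 with h | h | h
  · rw [max_eq_right h.le, zero_pow hk, mul_zero]
    refine (hasDerivAt_const t (0 : ℝ)).congr_of_eventuallyEq ?_
    filter_upwards [Iio_mem_nhds h] with s hs
    rw [max_eq_right (le_of_lt hs), zero_pow (Nat.succ_ne_zero k)]
  · subst h
    rw [max_self, zero_pow hk, mul_zero, hasDerivAt_iff_hasFDerivAt]
    have hO : (fun t : ℝ => max t 0 ^ (k + 1)) =O[𝓝 0] fun t => ‖t - 0‖ ^ (k + 1) := by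
      refine Asymptotics.IsBigO.of_bound 1 (Eventually.of_forall fun s => ?_)
      rw [one_mul, sub_zero, norm_pow, norm_pow, norm_norm]
      gcongr
      rw [Real.norm_of_nonneg (le_max_right _ _)]
      exact max_le (Real.le_norm_self s) (norm_nonneg _)
    rw [show ContinuousLinearMap.toSpanSingleton ℝ (0 : ℝ) = 0 by ext; simp]
    exact hO.hasFDerivAt (by omega)
  · rw [max_eq_left h.le]
    have := hasDerivAt_pow (k + 1) t
    simp only [Nat.cast_add, Nat.cast_one, Nat.add_sub_cancel] at this
    refine this.congr_of_eventuallyEq ?_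
    filter_upwards [Ioi_mem_nhds h] with s hs
    rw [max_eq_left (le_of_lt hs)]

theorem hasFDerivAt_ballWeight {k : ℕ} (hk : k ≠ 0) (y : EuclideanSpace ℝ (Fin N)) :
    HasFDerivAt (ballWeight (k + 1))
      ((-(2 * (k + 1) * ballWeight k y)) • innerSL ℝ y) y := by
  have h := (hasDerivAt_max_zero_pow hk (1 - ‖y‖ ^ 2)).comp_hasFDerivAt y
    ((hasStrictFDerivAt_norm_sq y).hasFDerivAt.const_sub 1)
  refine h.congr_fderiv ?_
  ext v
  simp [ballWeight]
  ring

theorem differentiable_ballWeight {k : ℕ} (hk : 2 ≤ k) :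
    Differentiable ℝ (ballWeight k : EuclideanSpace ℝ (Fin N) → ℝ) := by
  obtain ⟨k, rfl⟩ := Nat.exists_eq_add_of_le' hk
  exact fun y => (hasFDerivAt_ballWeight (Nat.succ_ne_zero k) y).differentiableAt

theorem fderiv_ballWeight_single {k : ℕ} (hk : k ≠ 0) (y : EuclideanSpace ℝ (Fin N))
    (i : Fin N) :
    fderiv ℝ (ballWeight (k + 1)) y (EuclideanSpace.single i 1) =
      -(2 * (k + 1) * (y i * ballWeight k y)) := by
  rw [(hasFDerivAt_ballWeight hk y).fderiv]
  simp [EuclideanSpace.inner_single_right]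
  ring

end BallWeight

section Laplacian

variable {N : ℕ}

theorem lap_eq_sum_fderiv {f : EuclideanSpace ℝ (Fin N) → ℝ} (hf : ContDiff ℝ 2 f)
    (x : EuclideanSpace ℝ (Fin N)) :
    lap f x = ∑ i : Fin N, fderiv ℝ (fun y => fderiv ℝ f y (EuclideanSpace.single i 1)) x
      (EuclideanSpace.single i 1) := by
  have hd : DifferentiableAt ℝ (fderiv ℝ f) x :=
    (hf.fderiv_right (m := 1) (by norm_num)).differentiable (by norm_num) x
  refine Finset.sum_congr rfl fun i _ => ?_
  rw [iteratedFDeriv_two_apply, fderiv_clm_apply hd (differentiableAt_const _)]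
  simp

theorem contDiff_lap {n : ℕ} {f : EuclideanSpace ℝ (Fin N) → ℝ}
    (hf : ContDiff ℝ (n + 2 : ℕ) f) : ContDiff ℝ n (lap f) := by
  have h2 : ContDiff ℝ 2 f := hf.of_le (by exact_mod_cast Nat.le_add_left 2 n)
  rw [show lap f = _ from funext (lap_eq_sum_fderiv h2)]
  refine ContDiff.sum fun i _ => ?_
  have h1 : ContDiff ℝ (n + 1 : ℕ) fun y => fderiv ℝ f y (EuclideanSpace.single i 1) :=
    (hf.fderiv_right (m := (n + 1 : ℕ)) (by norm_cast)).clm_apply contDiff_const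
  exact (h1.fderiv_right (m := n) (by norm_cast)).clm_apply contDiff_const

theorem lap_comp_add_smul {f : EuclideanSpace ℝ (Fin N) → ℝ} (hf : ContDiff ℝ 2 f)
    (x₀ : EuclideanSpace ℝ (Fin N)) (R : ℝ) (y : EuclideanSpace ℝ (Fin N)) :
    lap (fun y => f (x₀ + R • y)) y = R ^ 2 * lap f (x₀ + R • y) := by
  have key : ∀ {g : EuclideanSpace ℝ (Fin N) → ℝ} (_ : ContDiff ℝ 1 g)
      (y v : EuclideanSpace ℝ (Fin N)),
      fderiv ℝ (fun y => g (x₀ + R • y)) y v = R * fderiv ℝ g (x₀ + R • y) v := by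
    intro g hg y v
    have h1 : HasFDerivAt (fun y : EuclideanSpace ℝ (Fin N) => x₀ + R • y)
        (R • ContinuousLinearMap.id ℝ _) y := ((hasFDerivAt_id y).const_smul R).const_add x₀
    have := ((hg.differentiable (by norm_num) (x₀ + R • y)).hasFDerivAt.comp y h1).fderiv
    rw [Function.comp_def] at this
    rw [this]
    simp
  have h1 : ∀ i : Fin N, ContDiff ℝ 1 fun y => fderiv ℝ f y (EuclideanSpace.single i 1) :=
    fun i => (hf.fderiv_right (m := 1) (by norm_num)).clm_apply contDiff_const
  rw [lap_eq_sum_fderiv (by fun_prop), lap_eq_sum_fderiv hf, Finset.mul_sum]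
  refine Finset.sum_congr rfl fun i _ => ?_
  simp_rw [key (hf.of_le (by norm_num))]
  have hd : DifferentiableAt ℝ
      (fun y => fderiv ℝ f (x₀ + R • y) (EuclideanSpace.single i 1)) y :=
    ((h1 i).comp (by fun_prop :
      ContDiff ℝ 1 fun y : EuclideanSpace ℝ (Fin N) => x₀ + R • y)).differentiable (by norm_num) y
  rw [fderiv_const_mul hd]
  simp only [_root_.smul_apply, smul_eq_mul]
  rw [key (h1 i) y (EuclideanSpace.single i 1)]
  ring

theorem lap_const_mul {f : EuclideanSpace ℝ (Fin N) → ℝ} (hf : ContDiff ℝ 2 f) (c : ℝ)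
    (x : EuclideanSpace ℝ (Fin N)) : lap (fun y => c * f y) x = c * lap f x := by
  simp only [lap, Finset.mul_sum]
  refine Finset.sum_congr rfl fun i _ => ?_
  have := iteratedFDeriv_const_smul_apply' (a := c) (i := 2) (x := x) hf.contDiffAt
  simp only [smul_eq_mul] at this
  rw [this]; simp

theorem fderiv_apply_self_eq_sum (f : EuclideanSpace ℝ (Fin N) → ℝ)
    (y : EuclideanSpace ℝ (Fin N)) :
    fderiv ℝ f y y = ∑ i : Fin N, fderiv ℝ f y (EuclideanSpace.single i 1) * y i := by
  have h := congrArg (fderiv ℝ f y) ((EuclideanSpace.basisFun (Fin N) ℝ).sum_repr y)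
  rw [← h, map_sum]
  simp [mul_comm]

/-- Green's identity against a radial weight. -/
theorem integral_lap_mul_ballWeight {k : ℕ} (hk : k ≠ 0)
    {f : EuclideanSpace ℝ (Fin N) → ℝ} (hf : ContDiff ℝ 2 f) :
    ∫ y, lap f y * ballWeight (k + 1) y =
      2 * (k + 1) * ∫ y, fderiv ℝ f y y * ballWeight k y := by
  have h1 : ∀ i : Fin N, ContDiff ℝ 1 fun y => fderiv ℝ f y (EuclideanSpace.single i 1) :=
    fun i => (hf.fderiv_right (m := 1) (by norm_num)).clm_apply contDiff_const
  have h0 : ∀ i : Fin N, Continuous fun y => fderiv ℝ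
      (fun y => fderiv ℝ f y (EuclideanSpace.single i 1)) y (EuclideanSpace.single i 1) :=
    fun i => ((h1 i).continuous_fderiv (by norm_num)).clm_apply continuous_const
  have hI : ∀ i : Fin N, Integrable fun y : EuclideanSpace ℝ (Fin N) =>
      fderiv ℝ f y (EuclideanSpace.single i 1) * y i * ballWeight k y :=
    fun i => integrable_mul_ballWeight hk ((h1 i).continuous.mul (by fun_prop))
  simp_rw [lap_eq_sum_fderiv hf, fderiv_apply_self_eq_sum, Finset.sum_mul]
  rw [integral_finsetSum _ fun i _ => integrable_mul_ballWeight (Nat.succ_ne_zero k) (h0 i),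
    integral_finsetSum _ fun i _ => hI i, Finset.mul_sum]
  refine Finset.sum_congr rfl fun i _ => ?_
  have hpt : ∀ y : EuclideanSpace ℝ (Fin N), fderiv ℝ f y (EuclideanSpace.single i 1) *
      fderiv ℝ (ballWeight (k + 1)) y (EuclideanSpace.single i 1) =
      -(2 * (k + 1)) * (fderiv ℝ f y (EuclideanSpace.single i 1) * y i * ballWeight k y) := by
    intro y; rw [fderiv_ballWeight_single hk]; ring
  have := integral_mul_fderiv_eq_neg_fderiv_mul_of_integrable
    (f := fun y => fderiv ℝ f y (EuclideanSpace.single i 1)) (g := ballWeight (k + 1))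
    (v := EuclideanSpace.single i 1) (μ := volume)
    (integrable_mul_ballWeight (Nat.succ_ne_zero k) (h0 i))
    (by simp_rw [hpt]; exact (hI i).const_mul _)
    (integrable_mul_ballWeight (Nat.succ_ne_zero k) (h1 i).continuous)
    (fun y _ => (h1 i).differentiable (by norm_num) y)
    (fun y _ => differentiable_ballWeight (by omega) y)
  simp_rw [hpt] at this
  rw [integral_const_mul] at this
  linarith

theorem integral_fderiv_apply_self_mul_ballWeight {k : ℕ} (hk : k ≠ 0)
    {f : EuclideanSpace ℝ (Fin N) → ℝ} (hf : ContDiff ℝ 1 f) :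
    ∫ y, fderiv ℝ f y y * ballWeight (k + 1) y =
      2 * (k + 1) * (∫ y, f y * ballWeight k y) -
        (N + 2 * (k + 1)) * ∫ y, f y * ballWeight (k + 1) y := by
  have h0 : ∀ i : Fin N, Continuous fun y => fderiv ℝ f y (EuclideanSpace.single i 1) :=
    fun i => (hf.continuous_fderiv (by norm_num)).clm_apply continuous_const
  have hpt : ∀ (i : Fin N) (y : EuclideanSpace ℝ (Fin N)),
      HasFDerivAt (fun y : EuclideanSpace ℝ (Fin N) => y i * ballWeight (k + 1) y)
      (y i • ((-(2 * (k + 1) * ballWeight k y)) • innerSL ℝ y) +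
        ballWeight (k + 1) y • EuclideanSpace.proj i) y := fun i y =>
    HasFDerivAt.mul (EuclideanSpace.proj (𝕜 := ℝ) i).hasFDerivAt
      (hasFDerivAt_ballWeight hk y)
  have hpt' : ∀ (i : Fin N) (y : EuclideanSpace ℝ (Fin N)), f y *
      fderiv ℝ (fun y : EuclideanSpace ℝ (Fin N) => y i * ballWeight (k + 1) y) y
        (EuclideanSpace.single i 1) =
      f y * ballWeight (k + 1) y - 2 * (k + 1) * (f y * (y i) ^ 2 * ballWeight k y) := by
    intro i y
    rw [(hpt i y).fderiv]
    simp [EuclideanSpace.inner_single_right]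
    ring
  have hI : ∀ i : Fin N, Integrable fun y : EuclideanSpace ℝ (Fin N) =>
      f y * (y i) ^ 2 * ballWeight k y :=
    fun i => integrable_mul_ballWeight hk (hf.continuous.mul (by fun_prop))
  have hJ := integrable_mul_ballWeight (Nat.succ_ne_zero k) hf.continuous
  have hparts : ∀ i : Fin N, ∫ y, fderiv ℝ f y (EuclideanSpace.single i 1) * y i *
      ballWeight (k + 1) y = 2 * (k + 1) * (∫ y, f y * (y i) ^ 2 * ballWeight k y) -
        ∫ y, f y * ballWeight (k + 1) y := by
    intro i
    have := integral_mul_fderiv_eq_neg_fderiv_mul_of_integrable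
      (f := f) (g := fun y => y i * ballWeight (k + 1) y)
      (v := EuclideanSpace.single i 1) (μ := volume)
      (by simp_rw [← mul_assoc]; exact integrable_mul_ballWeight (Nat.succ_ne_zero k)
            ((h0 i).mul (by fun_prop)))
      (by simp_rw [hpt']; exact hJ.sub ((hI i).const_mul _))
      (by simp_rw [← mul_assoc]; exact integrable_mul_ballWeight (Nat.succ_ne_zero k)
            (hf.continuous.mul (by fun_prop)))
      (fun y _ => hf.differentiable (by norm_num) y)
      (fun y _ => (hpt i y).differentiableAt)
    simp_rw [hpt', ← mul_assoc] at this
    simp_rw [mul_assoc (2 * ((k : ℝ) + 1))] at this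
    rw [integral_sub hJ (by simpa only [mul_assoc] using (hI i).const_mul (2 * ((k : ℝ) + 1))),
      integral_const_mul] at this
    linarith
  simp_rw [fderiv_apply_self_eq_sum, Finset.sum_mul]
  have hG : ∀ i : Fin N, Integrable fun y : EuclideanSpace ℝ (Fin N) =>
      fderiv ℝ f y (EuclideanSpace.single i 1) * y i * ballWeight (k + 1) y :=
    fun i => integrable_mul_ballWeight (Nat.succ_ne_zero k) ((h0 i).mul (by fun_prop))
  rw [integral_finsetSum _ fun i _ => hG i, Finset.sum_congr rfl fun i _ => hparts i, Finset.sum_sub_distrib,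
    ← Finset.mul_sum, ← integral_finsetSum _ fun i _ => hI i]
  have hsum : ∀ y : EuclideanSpace ℝ (Fin N), ∑ i, f y * (y i) ^ 2 * ballWeight k y =
      f y * ballWeight k y - f y * ballWeight (k + 1) y := by
    intro y
    rw [← Finset.sum_mul, ← Finset.mul_sum, ← EuclideanSpace.real_norm_sq_eq, mul_assoc,
      norm_sq_mul_ballWeight hk]
    ring
  simp_rw [hsum]
  rw [integral_sub (integrable_mul_ballWeight hk hf.continuous) hJ]
  simp
  ring

theorem negLapPow_zero (u : EuclideanSpace ℝ (Fin N) → ℝ) : negLapPow 0 u = u := rfl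

theorem negLapPow_succ (m : ℕ) (u : EuclideanSpace ℝ (Fin N) → ℝ) :
    negLapPow (m + 1) u = fun x => -(lap (negLapPow m u) x) :=
  Function.iterate_succ_apply' _ _ _

theorem contDiff_negLapPow {m n : ℕ} {u : EuclideanSpace ℝ (Fin N) → ℝ}
    (hu : ContDiff ℝ (n + 2 * m : ℕ) u) : ContDiff ℝ n (negLapPow m u) := by
  induction m generalizing n with
  | zero => exact hu
  | succ m ih =>
    rw [negLapPow_succ]
    exact (contDiff_lap (ih (n := n + 2) (by convert hu using 2; ring))).neg

theorem negLapPow_comp_add_smul {m : ℕ} {u : EuclideanSpace ℝ (Fin N) → ℝ}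
    (hu : ContDiff ℝ (2 * m : ℕ) u) (x₀ : EuclideanSpace ℝ (Fin N)) (R : ℝ) :
    negLapPow m (fun y => u (x₀ + R • y)) =
      fun y => R ^ (2 * m) * negLapPow m u (x₀ + R • y) := by
  induction m generalizing u with
  | zero => simp [negLapPow_zero]
  | succ m ih =>
    have hm : ContDiff ℝ (2 * m : ℕ) u := hu.of_le (by norm_cast; omega)
    have hw : ContDiff ℝ 2 (negLapPow m u) :=
      contDiff_negLapPow (n := 2) (by convert hu using 2; ring)
    funext y
    rw [negLapPow_succ, ih hm, negLapPow_succ]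
    have hw' : ContDiff ℝ 2 fun y => negLapPow m u (x₀ + R • y) := hw.comp (by fun_prop)
    have := lap_const_mul hw' (R ^ (2 * m)) y
    simp only [this, lap_comp_add_smul hw]
    ring

end Laplacian

section BallMean

variable {N : ℕ}

/-- The (unnormalised) weighted mean of `f` over the ball of centre `x₀` and radius `R`. -/
noncomputable def ballMean (k : ℕ) (x₀ : EuclideanSpace ℝ (Fin N))
    (f : EuclideanSpace ℝ (Fin N) → ℝ) (R : ℝ) : ℝ :=
  ∫ y, f (x₀ + R • y) * ballWeight k y

theorem ballMean_neg (k : ℕ) (x₀ : EuclideanSpace ℝ (Fin N))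
    (f : EuclideanSpace ℝ (Fin N) → ℝ) (R : ℝ) :
    ballMean k x₀ (fun x => -(f x)) R = -ballMean k x₀ f R := by
  simp only [ballMean, neg_mul, integral_neg]

theorem ballMean_nonneg {k : ℕ} {f : EuclideanSpace ℝ (Fin N) → ℝ} (hf : ∀ x, 0 ≤ f x)
    (x₀ : EuclideanSpace ℝ (Fin N)) (R : ℝ) : 0 ≤ ballMean k x₀ f R :=
  integral_nonneg fun _ => mul_nonneg (hf _) (ballWeight_nonneg _ _)

theorem integral_ballWeight_pos {k : ℕ} (hk : k ≠ 0) :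
    0 < ∫ y : EuclideanSpace ℝ (Fin N), ballWeight k y :=
  (continuous_ballWeight k).integral_pos_of_hasCompactSupport_nonneg_nonzero
    (hasCompactSupport_ballWeight hk) (ballWeight_nonneg k) (x := 0) (by simp [ballWeight])

theorem hasDerivAt_ballMean {k : ℕ} (hk : k ≠ 0) {f : EuclideanSpace ℝ (Fin N) → ℝ}
    (hf : ContDiff ℝ 2 f) (x₀ : EuclideanSpace ℝ (Fin N)) {R : ℝ} (hR : R ≠ 0) :
    HasDerivAt (ballMean k x₀ f) (R / (2 * (k + 1)) * ballMean (k + 1) x₀ (lap f) R) R := by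
  have hc : Continuous fun z : ℝ × EuclideanSpace ℝ (Fin N) =>
      fderiv ℝ f (x₀ + z.1 • z.2) z.2 :=
    ((hf.continuous_fderiv (by norm_num)).comp (by fun_prop)).clm_apply continuous_snd
  obtain ⟨C, hC⟩ := ((isCompact_Icc (a := R - 1) (b := R + 1)).prod
    (isCompact_closedBall (0 : EuclideanSpace ℝ (Fin N)) 1)).exists_bound_of_continuousOn
    hc.continuousOn
  have hder := (hasDerivAt_integral_of_dominated_loc_of_deriv_le (μ := volume) (x₀ := R)
    (s := Set.Icc (R - 1) (R + 1))
    (F := fun R y => f (x₀ + R • y) * ballWeight k y)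
    (F' := fun R y => fderiv ℝ f (x₀ + R • y) y * ballWeight k y)
    (bound := fun y => C * ballWeight k y)
    (Icc_mem_nhds (by linarith) (by linarith))
    (Eventually.of_forall fun r => (integrable_mul_ballWeight hk
      (hf.continuous.comp (by fun_prop))).aestronglyMeasurable)
    (integrable_mul_ballWeight hk (hf.continuous.comp (by fun_prop)))
    (integrable_mul_ballWeight hk
      (hc.comp (Continuous.prodMk_right R))).aestronglyMeasurable
    (Eventually.of_forall fun y r hr => by
      rw [norm_mul, Real.norm_of_nonneg (ballWeight_nonneg k y)]
      by_cases hy : ‖y‖ ≤ 1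
      · exact mul_le_mul_of_nonneg_right (hC (r, y) ⟨hr, by simpa using hy⟩)
          (ballWeight_nonneg k y)
      · rw [ballWeight_eq_zero hk (not_le.1 hy).le, mul_zero, mul_zero])
    (integrable_mul_ballWeight hk continuous_const)
    (Eventually.of_forall fun y r _ => by
      have h1 : HasDerivAt (fun r : ℝ => x₀ + r • y) y r := by
        simpa using ((hasDerivAt_id r).smul_const y).const_add x₀
      exact ((hf.differentiable (by norm_num) _).hasFDerivAt.comp_hasDerivAt r h1).mul_const _)).2
  refine hder.congr_deriv ?_
  have hg : ContDiff ℝ 2 fun y => f (x₀ + R • y) := hf.comp (by fun_prop)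
  have hgd : ∀ y, fderiv ℝ (fun y => f (x₀ + R • y)) y y = R * fderiv ℝ f (x₀ + R • y) y := by
    intro y
    have h1 : HasFDerivAt (fun y : EuclideanSpace ℝ (Fin N) => x₀ + R • y)
        (R • ContinuousLinearMap.id ℝ _) y := ((hasFDerivAt_id y).const_smul R).const_add x₀
    have := ((hf.differentiable (by norm_num) (x₀ + R • y)).hasFDerivAt.comp y h1).fderiv
    rw [Function.comp_def] at this
    rw [this]
    simp
  have h := integral_lap_mul_ballWeight hk hg
  simp_rw [lap_comp_add_smul hf, hgd, mul_assoc, integral_const_mul] at h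
  unfold ballMean
  have hk' : (0 : ℝ) < k + 1 := by positivity
  field_simp
  apply mul_left_cancel₀ hR
  linarith

theorem continuous_ballMean {k : ℕ} (hk : k ≠ 0) {f : EuclideanSpace ℝ (Fin N) → ℝ}
    (hf : Continuous f) (x₀ : EuclideanSpace ℝ (Fin N)) : Continuous (ballMean k x₀ f) := by
  have := continuous_parametric_integral_of_continuous (μ := volume)
    (f := fun (R : ℝ) (y : EuclideanSpace ℝ (Fin N)) => f (x₀ + R • y) * ballWeight k y)
    ((hf.comp (by fun_prop)).mul ((continuous_ballWeight k).comp continuous_snd))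
    (isCompact_closedBall 0 1)
  convert this using 2 with R
  refine (setIntegral_eq_integral_of_forall_compl_eq_zero fun y hy => ?_).symm
  rw [ballWeight_eq_zero hk (not_le.1 (by simpa using hy)).le, mul_zero]

theorem monotoneOn_ballMean {k : ℕ} (hk : k ≠ 0) {f : EuclideanSpace ℝ (Fin N) → ℝ}
    (hf : ContDiff ℝ 2 f) (hlap : ∀ x, 0 ≤ lap f x) (x₀ : EuclideanSpace ℝ (Fin N)) :
    MonotoneOn (ballMean k x₀ f) (Set.Ici 0) := by
  refine monotoneOn_of_deriv_nonneg (convex_Ici 0)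
    (continuous_ballMean hk hf.continuous x₀).continuousOn ?_ ?_ <;> rw [interior_Ici]
  · exact fun R hR =>
      (hasDerivAt_ballMean hk hf x₀ (ne_of_gt hR)).differentiableAt.differentiableWithinAt
  · intro R hR
    rw [(hasDerivAt_ballMean hk hf x₀ (ne_of_gt hR)).deriv]
    have : (0 : ℝ) < R := hR
    exact mul_nonneg (by positivity) (ballMean_nonneg hlap x₀ R)

theorem eventually_pos_of_lap_ballMean {k : ℕ} (hk : k ≠ 0)
    {f : EuclideanSpace ℝ (Fin N) → ℝ} (hf : ContDiff ℝ 2 f) (x₀ : EuclideanSpace ℝ (Fin N))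
    {s : ℝ} (h : ∃ δ > 0, ∀ᶠ R in atTop, δ ≤ s * ballMean (k + 1) x₀ (lap f) R) :
    ∃ δ > 0, ∀ᶠ R in atTop, δ ≤ s * ballMean k x₀ f R := by
  obtain ⟨δ, hδ, h⟩ := h
  obtain ⟨R₀, hR₀⟩ := eventually_atTop.1 h
  set a := max R₀ 1 with ha
  have ha1 : 1 ≤ a := le_max_right _ _
  set c : ℝ := δ / (2 * (k + 1)) with hc
  have hcpos : 0 < c := by positivity
  have key : ∀ R, a ≤ R → c * R - c * a ≤ s * ballMean k x₀ f R - s * ballMean k x₀ f a := by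
    intro R hR
    have hmono : MonotoneOn (fun R => s * ballMean k x₀ f R - c * R) (Set.Ici a) := by
      have hd : ∀ r ∈ Set.Ioi a, HasDerivAt (fun R => s * ballMean k x₀ f R - c * R)
          (s * (r / (2 * (k + 1)) * ballMean (k + 1) x₀ (lap f) r) - c * 1) r := fun r hr =>
        ((hasDerivAt_ballMean hk hf x₀ (by
          have : a < r := hr
          linarith)).const_mul s).sub
          ((hasDerivAt_id r).const_mul c)
      refine monotoneOn_of_deriv_nonneg (convex_Ici a)
        (((continuous_ballMean hk hf.continuous x₀).const_mul s).sub
          (continuous_const.mul continuous_id)).continuousOn ?_ ?_ <;> rw [interior_Ici]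
      · exact fun r hr => (hd r hr).differentiableAt.differentiableWithinAt
      · intro r hr
        rw [(hd r hr).deriv]
        have har : a < r := hr
        have h1 := hR₀ r ((le_max_left R₀ 1).trans har.le)
        have h2 : c ≤ s * ballMean (k + 1) x₀ (lap f) r / (2 * (k + 1)) := by
          rw [hc]; gcongr
        have h3 : s * (r / (2 * (k + 1)) * ballMean (k + 1) x₀ (lap f) r) =
            r * (s * ballMean (k + 1) x₀ (lap f) r / (2 * (k + 1))) := by ring
        rw [h3]
        nlinarith
    have := hmono (Set.self_mem_Ici) hR hR
    simp only at this
    linarith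
  refine ⟨1, one_pos, ?_⟩
  filter_upwards [eventually_ge_atTop a,
    (tendsto_id.const_mul_atTop hcpos).eventually_ge_atTop
      (1 + c * a - s * ballMean k x₀ f a)] with R hR hR'
  have := key R hR
  simp only [id] at hR'
  linarith

theorem eventually_pos_of_negLapPow_ballMean {k j : ℕ} (hk : k ≠ 0)
    {f : EuclideanSpace ℝ (Fin N) → ℝ} (hf : ContDiff ℝ (2 * j : ℕ) f)
    (x₀ : EuclideanSpace ℝ (Fin N)) {s : ℝ}
    (h : ∃ δ > 0, ∀ᶠ R in atTop, δ ≤ s * ballMean (k + j) x₀ (negLapPow j f) R) :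
    ∃ δ > 0, ∀ᶠ R in atTop, δ ≤ (-1) ^ j * s * ballMean k x₀ f R := by
  induction j generalizing s with
  | zero => simpa [negLapPow_zero] using h
  | succ j ih =>
    have hw : ContDiff ℝ 2 (negLapPow j f) :=
      contDiff_negLapPow (n := 2) (by convert hf using 2; ring)
    have := ih (s := -s) (hf.of_le (by norm_cast; omega))
      (eventually_pos_of_lap_ballMean (by omega) hw x₀ (by
        simpa [negLapPow_succ, ballMean_neg, ← add_assoc] using h))
    simpa [pow_succ] using this

/-- A nonnegative, nontrivial `u` with `-(-Δ)^m u ≥ 0` has averages bounded away from zero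
on large balls around a suitable point. -/
theorem exists_eventually_le_ballMean {k m : ℕ} (hk : k ≠ 0)
    {u : EuclideanSpace ℝ (Fin N) → ℝ} (hu : ContDiff ℝ (2 * m : ℕ) u) (hpos : ∀ x, 0 ≤ u x)
    (hneg : ∀ x, negLapPow m u x ≤ 0) (hne : ∃ x, u x ≠ 0) :
    ∃ x₀, ∃ δ > 0, ∀ᶠ R in atTop, δ ≤ ballMean k x₀ u R := by
  induction m with
  | zero =>
    obtain ⟨x, hx⟩ := hne
    exact absurd (le_antisymm (hneg x) (hpos x)) hx
  | succ m ih =>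
    have hm : ContDiff ℝ (2 * m : ℕ) u := hu.of_le (by norm_cast; omega)
    by_cases h : ∀ x, negLapPow m u x ≤ 0
    · exact ih hm h
    push Not at h
    obtain ⟨x₀, hx₀⟩ := h
    have hw : ContDiff ℝ 2 (negLapPow m u) :=
      contDiff_negLapPow (n := 2) (by convert hu using 2; ring)
    have hmono := monotoneOn_ballMean (k := k + m) (by omega) hw
      (fun x => by have := hneg x; rw [negLapPow_succ] at this; linarith) x₀
    have h0 : 0 < ballMean (k + m) x₀ (negLapPow m u) 0 := by
      simp only [ballMean, zero_smul, add_zero, integral_const_mul]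
      exact mul_pos hx₀ (integral_ballWeight_pos (by omega))
    obtain ⟨δ, hδ, hev⟩ := eventually_pos_of_negLapPow_ballMean (s := 1) hk hm x₀ ⟨_, h0, by
      filter_upwards [eventually_ge_atTop 0] with R hR
      rw [one_mul]
      exact hmono Set.self_mem_Ici hR hR⟩
    refine ⟨x₀, δ, hδ, ?_⟩
    filter_upwards [hev] with R hR
    have hn := ballMean_nonneg (k := k) hpos x₀ R
    rcases neg_one_pow_eq_or ℝ m with h | h <;> rw [h] at hR <;> linarith

theorem abs_integral_negLapPow_mul_ballWeight_le (m : ℕ) {k : ℕ} (hk : k ≠ 0) :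
    ∃ C : ℝ, 0 ≤ C ∧ ∀ f : EuclideanSpace ℝ (Fin N) → ℝ, ContDiff ℝ (2 * m : ℕ) f →
      (∀ x, 0 ≤ f x) → |∫ y, negLapPow m f y * ballWeight (k + 2 * m) y| ≤
        C * ∫ y, f y * ballWeight k y := by
  induction m generalizing k with
  | zero =>
    refine ⟨1, zero_le_one, fun f _ hf => ?_⟩
    rw [negLapPow_zero, one_mul, mul_zero, add_zero, abs_of_nonneg]
    exact integral_nonneg fun y => mul_nonneg (hf y) (ballWeight_nonneg k y)
  | succ m ih =>
    obtain ⟨C₁, hC₁, h₁⟩ := ih hk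
    obtain ⟨C₂, hC₂, h₂⟩ := ih (Nat.succ_ne_zero k)
    set l := k + 2 * m with hl
    set a : ℝ := 2 * (l + 2) * (2 * (l + 1))
    set b : ℝ := 2 * (l + 2) * (N + 2 * (l + 1))
    have ha : 0 ≤ a := by positivity
    have hb : 0 ≤ b := by positivity
    refine ⟨a * C₁ + b * C₂, by positivity, fun f hf hpos => ?_⟩
    have hm : ContDiff ℝ (2 * m : ℕ) f := hf.of_le (by norm_cast; omega)
    have hw : ContDiff ℝ 2 (negLapPow m f) :=
      contDiff_negLapPow (n := 2) (by convert hf using 2; ring)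
    have e₁ := integral_lap_mul_ballWeight (k := l + 1) (by omega) hw
    rw [integral_fderiv_apply_self_mul_ballWeight (k := l) (by omega)
      (hw.of_le (by norm_num))] at e₁
    have e₂ : ∫ y, negLapPow (m + 1) f y * ballWeight (k + 2 * (m + 1)) y =
        b * (∫ y, negLapPow m f y * ballWeight (l + 1) y) -
          a * ∫ y, negLapPow m f y * ballWeight l y := by
      rw [show k + 2 * (m + 1) = l + 1 + 1 by omega]
      simp only [negLapPow_succ, neg_mul, integral_neg, e₁, a, b]
      push_cast
      ring
    have hmono : ∫ y, f y * ballWeight (k + 1) y ≤ ∫ y, f y * ballWeight k y :=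
      integral_mono (integrable_mul_ballWeight (Nat.succ_ne_zero k) hf.continuous)
        (integrable_mul_ballWeight hk hf.continuous) fun y =>
        mul_le_mul_of_nonneg_left (ballWeight_le_of_le (Nat.le_succ k) y) (hpos y)
    have i₁ := h₁ f hm hpos
    have i₂ := h₂ f hm hpos
    rw [show k.succ + 2 * m = l + 1 by omega] at i₂
    rw [e₂]
    calc _ ≤ b * |∫ y, negLapPow m f y * ballWeight (l + 1) y| +
          a * |∫ y, negLapPow m f y * ballWeight l y| := by
          refine (abs_sub _ _).trans ?_
          rw [abs_mul b, abs_mul a, abs_of_nonneg ha, abs_of_nonneg hb]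
      _ ≤ b * (C₂ * ∫ y, f y * ballWeight k y) + a * (C₁ * ∫ y, f y * ballWeight k y) := by
          gcongr
          exact i₂.trans (by gcongr)
      _ = _ := by ring

end BallMean

section Nonlocal

variable {N : ℕ}

theorem integrable_rpow_mul_kernel {Ψ : ℝ → ℝ} (hK : CondK N Ψ) {p : ℝ} (hp : 0 < p)
    {u : EuclideanSpace ℝ (Fin N) → ℝ} (hu : Continuous u) (hpos : ∀ x, 0 ≤ u x)
    (hint : IntegrableOn (fun y : EuclideanSpace ℝ (Fin N) => u y ^ p * Ψ (‖y‖ / 2))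
      {y : EuclideanSpace ℝ (Fin N) | 1 < ‖y‖})
    (x : EuclideanSpace ℝ (Fin N)) :
    Integrable fun y => u y ^ p * Ψ ‖y - x‖ := by
  have hup : Continuous fun y => u y ^ p := hu.rpow_const fun _ => Or.inr hp.le
  have hmp := measurePreserving_sub_right (volume : Measure (EuclideanSpace ℝ (Fin N))) x
  set ρ := 3 * ‖x‖ + 1 with hρ
  have hnear : IntegrableOn (fun y => u y ^ p * Ψ ‖y - x‖) (closedBall x ρ) := by
    refine IntegrableOn.continuousOn_mul hup.continuousOn ?_ (isCompact_closedBall x ρ)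
    have h := (hmp.integrableOn_comp_preimage (measurableEmbedding_subRight x)
      (f := fun y => Ψ ‖y‖) (s := closedBall 0 ρ)).2
      (hK.locInt.integrableOn_isCompact (isCompact_closedBall 0 ρ))
    have hs : (fun y => y - x) ⁻¹' closedBall 0 ρ = closedBall x ρ := by
      ext y; simp [dist_eq_norm]
    rwa [hs] at h
  have hfar : IntegrableOn (fun y => u y ^ p * Ψ ‖y - x‖) (closedBall x ρ)ᶜ := by
    have hsub : ∀ y ∈ (closedBall x ρ)ᶜ, 1 < ‖y‖ ∧ ‖y‖ / 2 ≤ ‖y - x‖ := by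
      intro y hy
      have h1 : ρ < ‖y - x‖ := by simpa [dist_eq_norm] using hy
      have h2 := norm_sub_le y x
      have h3 := norm_sub_norm_le y x
      have h4 := norm_nonneg x
      constructor <;> linarith
    refine Integrable.mono' (hint.mono_set fun y hy => (hsub y hy).1) ?_ ?_
    · exact (hup.aestronglyMeasurable.mul
        (hK.locInt.aestronglyMeasurable.comp_measurePreserving hmp)).restrict
    · filter_upwards [ae_restrict_mem measurableSet_closedBall.compl] with y hy
      obtain ⟨h1, h2⟩ := hsub y hy
      have h3 : 0 < ‖y‖ / 2 := by linarith
      have h4 : 0 ≤ u y ^ p := Real.rpow_nonneg (hpos y) p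
      rw [Real.norm_of_nonneg (mul_nonneg h4 (hK.pos _ (h3.trans_le h2)).le)]
      exact mul_le_mul_of_nonneg_left (hK.anti h3 (h3.trans_le h2) h2) h4
  rw [← integrableOn_univ, ← Set.union_compl_self (closedBall x ρ)]
  exact hnear.union hfar

theorem mul_setIntegral_ball_le_integral_kernel (hN : 1 ≤ N) {Ψ : ℝ → ℝ} (hK : CondK N Ψ)
    {p : ℝ} (hp : 0 < p) {u : EuclideanSpace ℝ (Fin N) → ℝ} (hu : Continuous u)
    (hpos : ∀ x, 0 ≤ u x)
    (hint : IntegrableOn (fun y : EuclideanSpace ℝ (Fin N) => u y ^ p * Ψ (‖y‖ / 2))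
      {y : EuclideanSpace ℝ (Fin N) | 1 < ‖y‖})
    {x₀ x : EuclideanSpace ℝ (Fin N)} {R : ℝ} (hx : x ∈ ball x₀ R) :
    Ψ (2 * R) * ∫ y in ball x₀ R, u y ^ p ≤ ∫ y, u y ^ p * Ψ ‖y - x‖ := by
  have : Nonempty (Fin N) := ⟨⟨0, hN⟩⟩
  have hup : Continuous fun y => u y ^ p := hu.rpow_const fun _ => Or.inr hp.le
  have hI := integrable_rpow_mul_kernel hK hp hu hpos hint x
  have hne : ∀ᵐ y : EuclideanSpace ℝ (Fin N), y ≠ x := by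
    simp [ae_iff]
  have hball : IntegrableOn (fun y => u y ^ p) (ball x₀ R) :=
    (hup.continuousOn.integrableOn_compact (isCompact_closedBall x₀ R)).mono_set
      ball_subset_closedBall
  calc Ψ (2 * R) * ∫ y in ball x₀ R, u y ^ p = ∫ y in ball x₀ R, Ψ (2 * R) * u y ^ p :=
        (integral_const_mul _ _).symm
    _ ≤ ∫ y in ball x₀ R, u y ^ p * Ψ ‖y - x‖ := by
        refine integral_mono_ae (hball.const_mul _) hI.integrableOn ?_
        filter_upwards [ae_restrict_mem measurableSet_ball, ae_restrict_of_ae hne] with y hy hyx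
        have h1 : 0 < ‖y - x‖ := norm_pos_iff.2 (sub_ne_zero.2 hyx)
        have h2 : ‖y - x‖ ≤ 2 * R := by
          rw [← dist_eq_norm]
          have := dist_triangle_right y x x₀
          rw [mem_ball] at hx hy
          linarith
        rw [mul_comm]
        exact mul_le_mul_of_nonneg_left (hK.anti h1 (h1.trans_le h2) h2)
          (Real.rpow_nonneg (hpos y) p)
    _ ≤ ∫ y, u y ^ p * Ψ ‖y - x‖ := by
        refine setIntegral_le_integral hI ?_
        filter_upwards [hne] with y hyx
        exact mul_nonneg (Real.rpow_nonneg (hpos y) p)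
          (hK.pos _ (norm_pos_iff.2 (sub_ne_zero.2 hyx))).le

open Pointwise in
theorem setIntegral_ball_comp_add_smul (f : EuclideanSpace ℝ (Fin N) → ℝ)
    (x₀ : EuclideanSpace ℝ (Fin N)) {R : ℝ} (hR : 0 < R) :
    ∫ x in ball x₀ R, f x = R ^ N * ∫ y in ball 0 1, f (x₀ + R • y) := by
  have h := Measure.setIntegral_comp_smul_of_pos (volume : Measure (EuclideanSpace ℝ (Fin N)))
    (fun z => f (x₀ + z)) (ball 0 1) hR
  have hs : R • ball (0 : EuclideanSpace ℝ (Fin N)) 1 = ball 0 R := by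
    rw [smul_unitBall_of_pos hR]
  have ht : ∫ z in ball 0 R, f (x₀ + z) = ∫ x in ball x₀ R, f x := by
    have := (measurePreserving_add_left (volume : Measure (EuclideanSpace ℝ (Fin N))) x₀
      ).setIntegral_preimage_emb (measurableEmbedding_addLeft x₀) f (ball x₀ R)
    rw [← this]
    congr 2
    ext z; simp
  rw [hs, ht, finrank_euclideanSpace_fin, smul_eq_mul] at h
  rw [h]
  have : R ^ N ≠ 0 := (pow_pos hR N).ne'
  field_simp

/-- Cauchy–Schwarz for the weighted means of powers. -/
theorem sq_integral_rpow_mul_ballWeight_le {k : ℕ} (hk : k ≠ 0) {p q : ℝ} (hp : 0 < p)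
    (hq : 0 < q) {v : EuclideanSpace ℝ (Fin N) → ℝ} (hv : Continuous v) (hpos : ∀ x, 0 ≤ v x) :
    (∫ y, v y ^ ((p + q) / 2) * ballWeight k y) ^ 2 ≤
      (∫ y in ball 0 1, v y ^ p) * ∫ y, v y ^ q * ballWeight (2 * k) y := by
  have hc : ∀ {r : ℝ}, 0 < r → Continuous fun y => v y ^ r := fun hr =>
    hv.rpow_const fun _ => Or.inr hr.le
  have hrs : ∀ (a r : ℝ), 0 ≤ a → (a ^ (r / 2)) ^ 2 = a ^ r := fun a r ha => by
    rw [← Real.rpow_mul_natCast ha]; congr 1; push_cast; ring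
  set F : EuclideanSpace ℝ (Fin N) → ℝ := (ball 0 1).indicator fun y => v y ^ (p / 2)
  set G : EuclideanSpace ℝ (Fin N) → ℝ := fun y => v y ^ (q / 2) * ballWeight k y
  have hFG : ∀ y, F y * G y = v y ^ ((p + q) / 2) * ballWeight k y := by
    intro y
    by_cases hy : y ∈ ball (0 : EuclideanSpace ℝ (Fin N)) 1
    · simp only [F, G, Set.indicator_of_mem hy]
      rw [← mul_assoc, add_div, Real.rpow_add_of_nonneg (hpos y) (by positivity) (by positivity)]
    · simp only [F, G, Set.indicator_of_notMem hy]
      rw [ballWeight_eq_zero hk (by simpa using hy)]; ring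
  have hF2 : ∀ y, F y ^ 2 = (ball 0 1).indicator (fun y => v y ^ p) y := by
    intro y
    by_cases hy : y ∈ ball (0 : EuclideanSpace ℝ (Fin N)) 1
    · simp only [F, Set.indicator_of_mem hy, hrs _ p (hpos y)]
    · simp only [F, Set.indicator_of_notMem hy]; norm_num
  have hG2 : ∀ y, G y ^ 2 = v y ^ q * ballWeight (2 * k) y := by
    intro y
    simp only [G, mul_pow, hrs _ q (hpos y), ballWeight, ← pow_mul, mul_comm k]
  have hFm : AEStronglyMeasurable F :=
    (hc (half_pos hp)).aestronglyMeasurable.indicator measurableSet_ball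
  have hGm : AEStronglyMeasurable G :=
    (integrable_mul_ballWeight hk (hc (half_pos hq))).aestronglyMeasurable
  have hFI : Integrable fun y => F y ^ 2 := by
    simp_rw [hF2]
    exact IntegrableOn.integrable_indicator
      (((hc hp).continuousOn.integrableOn_compact (isCompact_closedBall 0 1)).mono_set
        ball_subset_closedBall) measurableSet_ball
  have hGI : Integrable fun y => G y ^ 2 := by
    simp_rw [hG2]
    exact integrable_mul_ballWeight (by omega) (hc hq)
  have hCS := integral_mul_le_Lp_mul_Lq_of_nonneg (μ := volume) Real.HolderConjugate.two_two
    (f := F) (g := G)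
    (Eventually.of_forall fun y => Set.indicator_nonneg
      (fun y _ => Real.rpow_nonneg (hpos y) _) y)
    (Eventually.of_forall fun y =>
      mul_nonneg (Real.rpow_nonneg (hpos y) _) (ballWeight_nonneg k y))
    (by simpa using (memLp_two_iff_integrable_sq hFm).2 hFI)
    (by simpa using (memLp_two_iff_integrable_sq hGm).2 hGI)
  simp only [Real.rpow_two, hF2, hG2, hFG, integral_indicator measurableSet_ball] at hCS
  have hA : 0 ≤ ∫ y in ball 0 1, v y ^ p := integral_nonneg fun y => Real.rpow_nonneg (hpos y) _
  have hB : 0 ≤ ∫ y, v y ^ q * ballWeight (2 * k) y :=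
    integral_nonneg fun y => mul_nonneg (Real.rpow_nonneg (hpos y) _) (ballWeight_nonneg _ y)
  have hW : 0 ≤ ∫ y, v y ^ ((p + q) / 2) * ballWeight k y :=
    integral_nonneg fun y => mul_nonneg (Real.rpow_nonneg (hpos y) _) (ballWeight_nonneg _ y)
  rw [← Real.sqrt_eq_rpow, ← Real.sqrt_eq_rpow, ← Real.sqrt_mul hA] at hCS
  exact (Real.le_sqrt hW (mul_nonneg hA hB)).1 hCS

/-- A lower bound for the mean of `v ^ s`, `s ≥ 1`, in terms of the mean of `v`, when the
latter is bounded away from zero. -/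
theorem exists_mul_integral_le_integral_rpow {k : ℕ} (hk : k ≠ 0) {s δ : ℝ} (hs : 1 ≤ s)
    (hδ : 0 < δ) : ∃ c > 0, ∀ v : EuclideanSpace ℝ (Fin N) → ℝ, Continuous v →
      (∀ x, 0 ≤ v x) → δ ≤ ∫ y, v y * ballWeight k y →
      c * ∫ y, v y * ballWeight k y ≤ ∫ y, v y ^ s * ballWeight k y := by
  set n : ℝ := ∫ y : EuclideanSpace ℝ (Fin N), ballWeight k y
  have hn : 0 < n := integral_ballWeight_pos hk
  set ε : ℝ := δ / (2 * n) with hε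
  have hε0 : 0 < ε := by positivity
  set e : ℝ := ε ^ (s - 1)
  have he : 0 < e := Real.rpow_pos_of_pos hε0 _
  refine ⟨e / 2, by positivity, fun v hv hpos hZ => ?_⟩
  have hpt : ∀ y, e * (v y * ballWeight k y) ≤
      e * ε * ballWeight k y + v y ^ s * ballWeight k y := by
    intro y
    have hb := ballWeight_nonneg k y
    have hv0 := hpos y
    have : e * v y ≤ e * ε + v y ^ s := by
      rcases le_total (v y) ε with h | h
      · linarith [Real.rpow_nonneg hv0 s, mul_le_mul_of_nonneg_left h he.le]
      · have h1 : e ≤ v y ^ (s - 1) := Real.rpow_le_rpow hε0.le h (by linarith)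
        have h2 : v y ^ s = v y ^ (s - 1) * v y := by
          rw [← Real.rpow_add_one (hε0.trans_le h).ne']; ring_nf
        rw [h2]
        linarith [mul_pos he hε0, mul_le_mul_of_nonneg_right h1 hv0]
    calc e * (v y * ballWeight k y) = e * v y * ballWeight k y := by ring
      _ ≤ (e * ε + v y ^ s) * ballWeight k y := mul_le_mul_of_nonneg_right this hb
      _ = _ := add_mul _ _ _
  have hvs : Continuous fun y => v y ^ s := hv.rpow_const fun _ => Or.inr (by linarith)
  have hb : Integrable (ballWeight k : EuclideanSpace ℝ (Fin N) → ℝ) := by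
    simpa using integrable_mul_ballWeight (N := N) hk (continuous_const (y := (1 : ℝ)))
  have h := integral_mono ((integrable_mul_ballWeight hk hv).const_mul e)
    ((hb.const_mul (e * ε)).add (integrable_mul_ballWeight hk hvs)) hpt
  simp only [Pi.add_apply] at h
  rw [integral_const_mul, integral_add (hb.const_mul _) (integrable_mul_ballWeight hk hvs),
    integral_const_mul] at h
  have h1 : ε * n = δ / 2 := by rw [hε]; field_simp
  have h2 : e * ε * n = e * (δ / 2) := by rw [mul_assoc, h1]
  change _ ≤ e * ε * n + _ at h
  rw [h2] at h
  linarith [mul_le_mul_of_nonneg_left hZ he.le]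

end Nonlocal

theorem stmt_0 (N m : ℕ) (hN : 1 ≤ N) (hm : 1 ≤ m)
    (Ψ : ℝ → ℝ) (hK : CondK N Ψ)
    (p q : ℝ) (hp : 0 < p) (hq : 0 < q) (hpq : 2 ≤ p + q)
    (u : EuclideanSpace ℝ (Fin N) → ℝ)
    (hreg : ContDiff ℝ (2 * m) u)
    (hpos : ∀ x, 0 ≤ u x)
    (hint : IntegrableOn (fun y : EuclideanSpace ℝ (Fin N) => u y ^ p * Ψ (‖y‖ / 2))
      {y : EuclideanSpace ℝ (Fin N) | 1 < ‖y‖})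
    (hineq : ∀ x : EuclideanSpace ℝ (Fin N),
      (∫ y : EuclideanSpace ℝ (Fin N), u y ^ p * Ψ ‖y - x‖) * u x ^ q ≤ -(negLapPow m u x)) :
    ∀ x, u x = 0 := by
  by_contra! hne
  have hreg' : ContDiff ℝ (2 * m : ℕ) u := by exact_mod_cast hreg
  have hcu : Continuous u := hreg'.continuous
  have hk : 2 * m ≠ 0 := by omega
  have hlow : ∀ {x₀ x : EuclideanSpace ℝ (Fin N)} {R : ℝ}, x ∈ ball x₀ R →
      Ψ (2 * R) * (∫ y in ball x₀ R, u y ^ p) * u x ^ q ≤ -(negLapPow m u x) := fun hx =>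
    (mul_le_mul_of_nonneg_right
      (mul_setIntegral_ball_le_integral_kernel hN hK hp hcu hpos hint hx)
      (Real.rpow_nonneg (hpos _) q)).trans (hineq _)
  have hneg : ∀ x, negLapPow m u x ≤ 0 := by
    intro x
    have h := hlow (mem_ball_self (x := x) one_pos)
    have : 0 ≤ Ψ (2 * 1) * (∫ y in ball x 1, u y ^ p) * u x ^ q :=
      mul_nonneg (mul_nonneg (hK.pos _ (by norm_num)).le
        (integral_nonneg fun y => Real.rpow_nonneg (hpos y) _)) (Real.rpow_nonneg (hpos x) _)
    linarith
  obtain ⟨x₀, δ, hδ, hev⟩ := exists_eventually_le_ballMean hk hreg' hpos hneg hne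
  obtain ⟨C, hC, hbound⟩ := abs_integral_negLapPow_mul_ballWeight_le (N := N) m hk
  obtain ⟨c, hc, hrpow⟩ := exists_mul_integral_le_integral_rpow (N := N) hk
    (show 1 ≤ (p + q) / 2 by linarith) hδ
  have htend : Tendsto (fun R : ℝ => (2 * R) ^ N * Ψ (2 * R)) atTop atTop :=
    hK.tendsto.comp (tendsto_id.const_mul_atTop two_pos)
  obtain ⟨R, hR1, hZ, hbig⟩ := ((eventually_ge_atTop 1).and (hev.and
    (htend.eventually_gt_atTop (2 ^ N * (C / (c ^ 2 * δ)))))).exists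
  have hR : 0 < R := by linarith
  set v : EuclideanSpace ℝ (Fin N) → ℝ := fun y => u (x₀ + R • y) with hv
  have hvreg : ContDiff ℝ (2 * m : ℕ) v := hreg'.comp (by fun_prop)
  have hvpos : ∀ y, 0 ≤ v y := fun y => hpos _
  set Z : ℝ := ∫ y, v y * ballWeight (2 * m) y
  change δ ≤ Z at hZ
  have hZ0 : 0 < Z := by linarith
  set A : ℝ := ∫ y in ball 0 1, v y ^ p
  set B : ℝ := ∫ y, v y ^ q * ballWeight (2 * (2 * m)) y
  have hAB : (c * Z) ^ 2 ≤ A * B :=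
    (pow_le_pow_left₀ (by positivity) (hrpow v hvreg.continuous hvpos hZ) 2).trans
      (sq_integral_rpow_mul_ballWeight_le hk hp hq hvreg.continuous hvpos)
  have hA : ∫ x in ball x₀ R, u x ^ p = R ^ N * A :=
    setIntegral_ball_comp_add_smul (fun x => u x ^ p) x₀ hR
  have hvq : Continuous fun y => v y ^ q := hvreg.continuous.rpow_const fun _ => Or.inr hq.le
  have hupper : Ψ (2 * R) * (R ^ N * A) * B ≤ C * Z := by
    have hw : Continuous (negLapPow m v) :=
      (contDiff_negLapPow (n := 0) (by simpa using hvreg)).continuous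
    have hΨ := hK.pos (2 * R) (by positivity)
    calc Ψ (2 * R) * (R ^ N * A) * B
        = ∫ y, Ψ (2 * R) * (R ^ N * A) * v y ^ q * ballWeight (2 * (2 * m)) y := by
          simp_rw [mul_assoc (Ψ (2 * R) * (R ^ N * A))]
          rw [integral_const_mul]
      _ ≤ ∫ y, -negLapPow m v y * ballWeight (2 * m + 2 * m) y := by
          refine integral_mono
            (integrable_mul_ballWeight (by omega) (continuous_const.mul hvq))
            (integrable_mul_ballWeight (by omega) hw.neg) fun y => ?_
          rw [← two_mul (2 * m)]
          by_cases hy : ‖y‖ < 1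
          · refine mul_le_mul_of_nonneg_right ?_ (ballWeight_nonneg _ _)
            have hmem : x₀ + R • y ∈ ball x₀ R := by
              simp only [mem_ball, dist_self_add_left, norm_smul, Real.norm_of_nonneg hR.le]
              nlinarith
            have h1 := hlow hmem
            rw [hA] at h1
            have h2 := hneg (x₀ + R • y)
            have h3 : 1 ≤ R ^ (2 * m) := one_le_pow₀ hR1
            simp only [hv, negLapPow_comp_add_smul hreg']
            nlinarith
          · rw [ballWeight_eq_zero (by omega) (not_lt.1 hy), mul_zero, mul_zero]
      _ ≤ C * Z := by
          simp only [neg_mul, integral_neg]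
          exact (neg_le_abs _).trans (hbound v hvreg hvpos)
  have hΨR : 0 < R ^ N * Ψ (2 * R) := mul_pos (by positivity) (hK.pos _ (by positivity))
  have hbig' : C / (c ^ 2 * δ) < R ^ N * Ψ (2 * R) := by
    rw [mul_pow, mul_assoc] at hbig
    exact lt_of_mul_lt_mul_left hbig (by positivity)
  rw [div_lt_iff₀ (by positivity)] at hbig'
  have h1 : R ^ N * Ψ (2 * R) * (c * Z) ^ 2 ≤ C * Z := by
    refine (mul_le_mul_of_nonneg_left hAB hΨR.le).trans (le_of_eq_of_le ?_ hupper)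
    ring
  have h2 : R ^ N * Ψ (2 * R) * (c ^ 2 * δ) * Z ≤ R ^ N * Ψ (2 * R) * (c * Z) ^ 2 := by
    have : c ^ 2 * δ * Z ≤ (c * Z) ^ 2 := by
      rw [mul_pow, sq Z, mul_assoc]
      gcongr
    rw [mul_assoc]
    exact mul_le_mul_of_nonneg_left this hΨR.le
  nlinarith
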